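/- Gaussian boundary-layer estimate (the key computation in the proof of assertion 1 of the appendix Theorem, that smooth domains are good sets): for every integer d ≥ 1 and all constants C > 0 and M > 0, there exists C' > 0 such that for every ℏ ∈ (0, 1], ∫∫ exp(−‖x − y‖²/(C·ℏ)) dx dy ≤ C' · ℏ^{(d+1)/2}, where the integral is over pairs (x, y) with x ∈ [−M, M]^d, y ∈ [−M, M]^d, x₁ ≥ 0 and y₁ ≤ 0, and ‖·‖ is the Euclidean norm on ℝ^d. -/

import Mathlib

open MeasureTheory

theorem gbl_integrable (d : ℕ) (C : ℝ) (hC : 0 < C) :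
    Integrable (fun z : EuclideanSpace ℝ (Fin d) => ‖z‖ * Real.exp (-‖z‖ ^ 2 / C)) := by
  have h0 : Integrable (fun z : EuclideanSpace ℝ (Fin d) => Real.exp (-‖z‖ ^ 2 / (2 * C))) := by
    have hb : 0 < ((1 / (2 * C) : ℝ) : ℂ).re := by
      rw [Complex.ofReal_re]; positivity
    have h := GaussianFourier.integrable_cexp_neg_mul_sq_norm_add
      (V := EuclideanSpace ℝ (Fin d)) hb 0 0
    refine h.norm.congr (Filter.Eventually.of_forall fun z => ?_)
    simp only [Complex.norm_exp]
    congr 1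
    have : (-((1 / (2 * C) : ℝ) : ℂ) * (‖z‖ : ℂ) ^ 2 +
        0 * ((inner ℝ (0 : EuclideanSpace ℝ (Fin d)) z : ℝ) : ℂ)) =
        ((-‖z‖ ^ 2 / (2 * C) : ℝ) : ℂ) := by
      push_cast; ring
    rw [this, Complex.ofReal_re]
  refine (h0.const_mul (1 + 2 * C)).mono' (by fun_prop) (Filter.Eventually.of_forall fun z => ?_)
  have ht := norm_nonneg z
  rw [Real.norm_of_nonneg (by positivity)]
  set t := ‖z‖
  have e : Real.exp (-t ^ 2 / (2 * C)) =
      Real.exp (t ^ 2 / (2 * C)) * Real.exp (-t ^ 2 / C) := by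
    rw [← Real.exp_add]; congr 1; field_simp; ring
  rw [e, ← mul_assoc]
  refine mul_le_mul_of_nonneg_right ?_ (Real.exp_pos _).le
  have h1 := Real.add_one_le_exp (t ^ 2 / (2 * C))
  have h2 : t ≤ (1 + 2 * C) * (t ^ 2 / (2 * C) + 1) := by
    have h3 : 2 * C * (t ^ 2 / (2 * C)) = t ^ 2 := by field_simp
    have h4 : 0 ≤ t ^ 2 / (2 * C) := by positivity
    nlinarith [sq_nonneg (t - 1)]
  exact h2.trans (mul_le_mul_of_nonneg_left h1 (by positivity))

theorem gbl_scale (d : ℕ) (C s : ℝ) (hC : 0 < C) (hs : 0 < s) :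
    Integrable (fun z : EuclideanSpace ℝ (Fin d) => ‖z‖ * Real.exp (-‖z‖ ^ 2 / (C * s ^ 2))) ∧
    ∫ z : EuclideanSpace ℝ (Fin d), ‖z‖ * Real.exp (-‖z‖ ^ 2 / (C * s ^ 2)) =
      s ^ (d + 1) * ∫ z : EuclideanSpace ℝ (Fin d), ‖z‖ * Real.exp (-‖z‖ ^ 2 / C) := by
  have e : (fun z : EuclideanSpace ℝ (Fin d) => ‖z‖ * Real.exp (-‖z‖ ^ 2 / (C * s ^ 2))) =
      fun z => s * (fun w : EuclideanSpace ℝ (Fin d) => ‖w‖ * Real.exp (-‖w‖ ^ 2 / C))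
        (s⁻¹ • z) := by
    funext z
    simp only [norm_smul, norm_inv, Real.norm_of_nonneg hs.le]
    rw [← mul_assoc, ← mul_assoc, mul_inv_cancel₀ hs.ne', one_mul]
    congr 2
    field_simp
  refine ⟨?_, ?_⟩
  · rw [e]
    exact ((gbl_integrable d C hC).comp_smul (inv_ne_zero hs.ne')).const_mul s
  · rw [e, integral_const_mul, Measure.integral_comp_smul volume
      (fun w : EuclideanSpace ℝ (Fin d) => ‖w‖ * Real.exp (-‖w‖ ^ 2 / C)) s⁻¹]
    simp only [finrank_euclideanSpace, Fintype.card_fin, smul_eq_mul, inv_pow, inv_inv]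
    rw [abs_of_pos (by positivity)]
    ring

theorem gbl_box (d : ℕ) (hd : 1 ≤ d) (M : ℝ) (z : EuclideanSpace ℝ (Fin d)) :
    volume {y : EuclideanSpace ℝ (Fin d) | (∀ i, y i ∈ Set.Icc (-M) M) ∧
      -z ⟨0, hd⟩ ≤ y ⟨0, hd⟩ ∧ y ⟨0, hd⟩ ≤ 0} ≤
      ENNReal.ofReal ‖z‖ * ENNReal.ofReal (2 * M) ^ (d - 1) := by
  classical
  set T : Fin d → Set ℝ := fun i => if i = ⟨0, hd⟩ then Set.Icc (-z ⟨0, hd⟩) 0 else Set.Icc (-M) M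
  have hT : MeasurableSet (Set.univ.pi T) := by
    refine MeasurableSet.univ_pi fun i => ?_
    simp only [T]; split_ifs <;> exact measurableSet_Icc
  have hsub : {y : EuclideanSpace ℝ (Fin d) | (∀ i, y i ∈ Set.Icc (-M) M) ∧
      -z ⟨0, hd⟩ ≤ y ⟨0, hd⟩ ∧ y ⟨0, hd⟩ ≤ 0} ⊆
      (WithLp.ofLp : EuclideanSpace ℝ (Fin d) → (Fin d → ℝ)) ⁻¹' (Set.univ.pi T) := by
    rintro y ⟨h1, h2, h3⟩ i -
    simp only [T]
    split_ifs with h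
    · subst h; exact ⟨h2, h3⟩
    · exact h1 i
  refine (measure_mono hsub).trans ?_
  rw [(PiLp.volume_preserving_ofLp (Fin d)).measure_preimage hT.nullMeasurableSet,
    volume_pi_pi, ← Finset.mul_prod_erase _ _ (Finset.mem_univ (⟨0, hd⟩ : Fin d))]
  gcongr
  · simp only [T, if_true, Real.volume_Icc]
    apply ENNReal.ofReal_le_ofReal
    have := PiLp.norm_apply_le z ⟨0, hd⟩
    rw [Real.norm_eq_abs] at this
    linarith [le_abs_self (z ⟨0, hd⟩)]
  · rw [Finset.prod_congr rfl (g := fun _ => ENNReal.ofReal (2 * M))]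
    · simp [Finset.card_erase_of_mem]
    · intro i hi
      simp only [T, if_neg (Finset.ne_of_mem_erase hi), Real.volume_Icc]
      congr 1; ring

theorem gbl_main (d : ℕ) (hd : 1 ≤ d) (M K : ℝ) (hM : 0 < M)
    (hI : Integrable (fun z : EuclideanSpace ℝ (Fin d) => ‖z‖ * Real.exp (-‖z‖ ^ 2 / K))) :
      (∫ p in {p : EuclideanSpace ℝ (Fin d) × EuclideanSpace ℝ (Fin d) |
            (∀ i, p.1 i ∈ Set.Icc (-M) M) ∧ (∀ i, p.2 i ∈ Set.Icc (-M) M) ∧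
            0 ≤ p.1 ⟨0, hd⟩ ∧ p.2 ⟨0, hd⟩ ≤ 0},
          Real.exp (-‖p.1 - p.2‖ ^ 2 / K) ∂volume)
        ≤ (2 * M) ^ (d - 1) *
          ∫ z : EuclideanSpace ℝ (Fin d), ‖z‖ * Real.exp (-‖z‖ ^ 2 / K) := by
  set S := {p : EuclideanSpace ℝ (Fin d) × EuclideanSpace ℝ (Fin d) |
            (∀ i, p.1 i ∈ Set.Icc (-M) M) ∧ (∀ i, p.2 i ∈ Set.Icc (-M) M) ∧
            0 ≤ p.1 ⟨0, hd⟩ ∧ p.2 ⟨0, hd⟩ ≤ 0} with hS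
  have hSm : MeasurableSet S := by
    refine IsClosed.measurableSet ?_
    simp only [hS, Set.mem_Icc, Set.ofPred_and, Set.ofPred_forall]
    refine (isClosed_iInter fun i => (isClosed_le (by fun_prop) (by fun_prop)).inter
      (isClosed_le (by fun_prop) (by fun_prop))).inter
      ((isClosed_iInter fun i => (isClosed_le (by fun_prop) (by fun_prop)).inter
      (isClosed_le (by fun_prop) (by fun_prop))).inter
      ((isClosed_le (by fun_prop) (by fun_prop)).inter (isClosed_le (by fun_prop) (by fun_prop))))
  rw [integral_eq_lintegral_of_nonneg_ae (Filter.Eventually.of_forall fun p => (Real.exp_pos _).le)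
    (by fun_prop), ← lintegral_indicator hSm]
  set F : EuclideanSpace ℝ (Fin d) × EuclideanSpace ℝ (Fin d) → ENNReal :=
    S.indicator fun p => ENNReal.ofReal (Real.exp (-‖p.1 - p.2‖ ^ 2 / K)) with hF
  have hFm : Measurable F := Measurable.indicator (by fun_prop) hSm
  have key : ∫⁻ p, F p ≤ ENNReal.ofReal ((2 * M) ^ (d - 1) *
      ∫ z : EuclideanSpace ℝ (Fin d), ‖z‖ * Real.exp (-‖z‖ ^ 2 / K)) := by
    have hr : ENNReal.ofReal ((2 * M) ^ (d - 1) *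
        ∫ z : EuclideanSpace ℝ (Fin d), ‖z‖ * Real.exp (-‖z‖ ^ 2 / K)) =
        ∫⁻ z : EuclideanSpace ℝ (Fin d), ENNReal.ofReal (Real.exp (-‖z‖ ^ 2 / K)) *
          (ENNReal.ofReal ‖z‖ * ENNReal.ofReal (2 * M) ^ (d - 1)) := by
      rw [← integral_const_mul, ofReal_integral_eq_lintegral_ofReal (hI.const_mul _)
        (Filter.Eventually.of_forall fun z => by positivity)]
      refine lintegral_congr fun z => ?_
      rw [← ENNReal.ofReal_pow (by positivity), ← ENNReal.ofReal_mul (by positivity),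
        ← ENNReal.ofReal_mul (by positivity)]
      congr 1; ring
    rw [hr, Measure.volume_eq_prod, lintegral_prod_symm' _ hFm]
    have h1 : ∀ y : EuclideanSpace ℝ (Fin d), ∫⁻ x, F (x, y) = ∫⁻ z, F (z + y, y) := fun y =>
      (lintegral_add_right_eq_self (fun x => F (x, y)) y).symm
    simp_rw [h1]
    rw [lintegral_lintegral_swap (by
      exact (hFm.comp (f := fun q : EuclideanSpace ℝ (Fin d) × EuclideanSpace ℝ (Fin d) =>
        (q.2 + q.1, q.1)) (by fun_prop)).aemeasurable)]
    refine lintegral_mono fun z => ?_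
    set B := {y : EuclideanSpace ℝ (Fin d) | (∀ i, y i ∈ Set.Icc (-M) M) ∧
      -z ⟨0, hd⟩ ≤ y ⟨0, hd⟩ ∧ y ⟨0, hd⟩ ≤ 0} with hB
    calc ∫⁻ y, F (z + y, y)
        ≤ ∫⁻ y, B.indicator (fun _ => ENNReal.ofReal (Real.exp (-‖z‖ ^ 2 / K))) y := by
          refine lintegral_mono fun y => ?_
          by_cases h : (z + y, y) ∈ S
          · have hy : y ∈ B := by
              obtain ⟨-, h2, h3, h4⟩ := h
              refine ⟨h2, ?_, h4⟩
              simp only [PiLp.add_apply] at h3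
              linarith
            rw [hF, Set.indicator_of_mem h, Set.indicator_of_mem hy]
            simp
          · rw [hF, Set.indicator_of_notMem h]; exact zero_le
      _ ≤ ENNReal.ofReal (Real.exp (-‖z‖ ^ 2 / K)) * volume B :=
          lintegral_indicator_const_le _ _
      _ ≤ _ := by gcongr; exact gbl_box d hd M z
  refine ENNReal.toReal_le_of_le_ofReal ?_ key
  exact mul_nonneg (by positivity) (integral_nonneg fun z => by positivity)


open MeasureTheory

/-- Gaussian boundary-layer estimate (key computation in the proof of assertion 1 of the
appendix Theorem, that smooth domains are good sets): for every `d ≥ 1`, `C > 0`, `M > 0`,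
there is `C' > 0` such that for all `ℏ ∈ (0, 1]`,
`∫∫_{x,y ∈ [−M,M]^d, x₁ ≥ 0, y₁ ≤ 0} exp(−‖x−y‖²/(Cℏ)) dx dy ≤ C' ℏ^{(d+1)/2}`. -/
theorem gaussian_boundary_layer_estimate
    (d : ℕ) (hd : 1 ≤ d) (C M : ℝ) (hC : 0 < C) (hM : 0 < M) :
    ∃ C' : ℝ, 0 < C' ∧ ∀ ℏ ∈ Set.Ioc (0 : ℝ) 1,
      (∫ p in {p : EuclideanSpace ℝ (Fin d) × EuclideanSpace ℝ (Fin d) |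
            (∀ i, p.1 i ∈ Set.Icc (-M) M) ∧ (∀ i, p.2 i ∈ Set.Icc (-M) M) ∧
            0 ≤ p.1 ⟨0, hd⟩ ∧ p.2 ⟨0, hd⟩ ≤ 0},
          Real.exp (-‖p.1 - p.2‖ ^ 2 / (C * ℏ)) ∂volume)
        ≤ C' * ℏ ^ (((d : ℝ) + 1) / 2) := by
  have hJ : 0 ≤ ∫ z : EuclideanSpace ℝ (Fin d), ‖z‖ * Real.exp (-‖z‖ ^ 2 / C) :=
    integral_nonneg fun z => by positivity
  refine ⟨(2 * M) ^ (d - 1) *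
    (∫ z : EuclideanSpace ℝ (Fin d), ‖z‖ * Real.exp (-‖z‖ ^ 2 / C)) + 1, by positivity, ?_⟩
  rintro h ⟨h0, -⟩
  have hs : 0 < √h := Real.sqrt_pos.mpr h0
  obtain ⟨hI, hE⟩ := gbl_scale d C (√h) hC hs
  rw [Real.sq_sqrt h0.le] at hI hE
  refine (gbl_main d hd M (C * h) hM hI).trans ?_
  rw [hE]
  have hp : h ^ (((d : ℝ) + 1) / 2) = √h ^ (d + 1) := by
    rw [Real.sqrt_eq_rpow, ← Real.rpow_natCast, ← Real.rpow_mul h0.le]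
    congr 1; push_cast; ring
  rw [hp]
  have : 0 < √h ^ (d + 1) := by positivity
  nlinarith
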